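/- Let n ≥ 2 be an integer and let λ be an integer with 1 ≤ λ and n − λ > √n (the sub-Halfin-Whitt regime with integer arrival rate). Let ν_n be the stationary distribution of the M/M/n queue with arrival rate λ and unit service rate, and set γ = 1 − n/((n−λ)·(n−λ+1)). Then γ > 0, and for every f : ℕ → ℝ with Σ_q ν_n(q)·f(q)² < ∞: Var_{ν_n}(f) ≤ (1/γ)·E(f,f). (This is the Poincaré inequality underlying the mixing bound χ(π_{n,t}, ν_n) ≤ e^{−γt}·χ(π_{n,0}, ν_n); writing λ = n − n^{1−α}, γ = 1 − n^{2α−1}/(1 + n^{α−1}) → 1 as n → ∞ when α ∈ (0,1/2).) -/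

import Mathlib

/-- Adding the resistances `1` and `s` in series; for `s = 0` the second potential must vanish. -/
lemma sq_div_add_one_le (s x y : ℝ) (hs : 0 ≤ s) (h0 : s = 0 → x = 0) :
    y ^ 2 / (s + 1) ≤ (y - x) ^ 2 + x ^ 2 / s := by
  rcases hs.eq_or_lt with h | h
  · simp [← h, h0 h.symm]
  · rw [div_le_iff₀ (by positivity)]
    have : ((y - x) ^ 2 + x ^ 2 / s) * (s + 1) - y ^ 2 = (s * (y - x) - x) ^ 2 / s := by
      field_simp
      ring
    have : 0 ≤ (s * (y - x) - x) ^ 2 / s := by positivity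
    linarith

/-- Drift bound on the side `q < lam`, with barrier `lam - q`. -/
lemma sum_range_le_of_drift_below (n lam : ℕ) (hln : lam < n) (ν g : ℕ → ℝ)
    (hpos : ∀ q, 0 < ν q)
    (hbal : ∀ q, (lam : ℝ) * ν q = (min (q + 1) n : ℕ) * ν (q + 1))
    (hg : g lam = 0) (γ : ℝ) (hγ1 : γ ≤ 1) (M : ℕ) (hM : M ≤ lam) :
    γ * ∑ q ∈ Finset.range M, ν q * g q ^ 2 ≤
      ∑ q ∈ Finset.range M, (lam : ℝ) * ν q * (g (q + 1) - g q) ^ 2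
        + M * ν M * (g M ^ 2 / ((lam : ℝ) - M)) := by
  induction M with
  | zero => simp
  | succ M ih =>
    have ih := ih (by omega)
    have hMl : (M : ℝ) + 1 ≤ lam := by exact_mod_cast hM
    have hb := hbal M
    rw [min_eq_left (by omega : M + 1 ≤ n)] at hb
    have key := sq_div_add_one_le ((lam : ℝ) - (M + 1)) (g (M + 1)) (g M) (by linarith) (by
      intro h
      have : lam = M + 1 := by
        have : (lam : ℝ) = ((M + 1 : ℕ) : ℝ) := by push_cast; linarith
        exact_mod_cast this
      rw [← this, hg])
    rw [show (lam : ℝ) - (M + 1) + 1 = lam - M by ring] at key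
    have hs : (0 : ℝ) < lam - M := by linarith
    have key2 := mul_le_mul_of_nonneg_left key
      (mul_nonneg (Nat.cast_nonneg lam) (hpos M).le : (0 : ℝ) ≤ lam * ν M)
    have hsplit : (lam : ℝ) * ν M * (g M ^ 2 / (lam - M))
        = ν M * g M ^ 2 + M * ν M * (g M ^ 2 / (lam - M)) := by
      field_simp
      ring
    have hγ : γ * (ν M * g M ^ 2) ≤ ν M * g M ^ 2 :=
      mul_le_of_le_one_left (mul_nonneg (hpos M).le (sq_nonneg _)) hγ1
    rw [Finset.sum_range_succ, Finset.sum_range_succ, ← hb]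
    push_cast
    have hsymm : (g M - g (M + 1)) ^ 2 = (g (M + 1) - g M) ^ 2 := by ring
    rw [hsymm] at key2
    nlinarith [key2, hsplit, hγ, ih]

/-- Drift bound on all of `ℕ`, with barrier `q - lam` for `lam ≤ q ≤ n` and geometric
growth of rate `1 + 1 / (n - lam)` beyond `n`. -/
lemma sum_range_le_of_drift_above (n lam : ℕ) (hln : lam < n) (ν g : ℕ → ℝ)
    (hpos : ∀ q, 0 < ν q)
    (hbal : ∀ q, (lam : ℝ) * ν q = (min (q + 1) n : ℕ) * ν (q + 1))
    (hg : g lam = 0) (γ : ℝ) (hγ1 : γ ≤ 1)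
    (hγ : γ = 1 - (n : ℝ) / (((n : ℝ) - lam) * ((n : ℝ) - lam + 1))) (j : ℕ) :
    γ * ∑ q ∈ Finset.range (lam + j + 1), ν q * g q ^ 2
        + lam * ν (lam + j) * (g (lam + j) ^ 2 / (min j (n - lam) : ℕ)) ≤
      ∑ q ∈ Finset.range (lam + j), (lam : ℝ) * ν q * (g (q + 1) - g q) ^ 2 := by
  induction j with
  | zero =>
    have h := sum_range_le_of_drift_below n lam hln ν g hpos hbal hg γ hγ1 lam le_rfl
    rw [add_zero, Finset.sum_range_succ]
    simpa [hg] using h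
  | succ j ih =>
    have hlnR : (lam : ℝ) < n := by exact_mod_cast hln
    have hb := hbal (lam + j)
    have key := sq_div_add_one_le ((min j (n - lam) : ℕ) : ℝ) (g (lam + j)) (g (lam + j + 1))
      (Nat.cast_nonneg _) (by
        intro h
        have : j = 0 := by
          have : min j (n - lam) = 0 := by exact_mod_cast h
          omega
        simp [this, hg])
    have key2 := mul_le_mul_of_nonneg_left key
      (mul_nonneg (Nat.cast_nonneg lam) (hpos (lam + j)).le : (0 : ℝ) ≤ lam * ν (lam + j))
    have hrate : γ + lam / ((min (j + 1) (n - lam) : ℕ) : ℝ)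
        ≤ ((min (lam + j + 1) n : ℕ) : ℝ) / ((min j (n - lam) : ℕ) + 1) := by
      rcases lt_or_ge j (n - lam) with h | h
      · rw [min_eq_left (by omega), min_eq_left (by omega), min_eq_left (by omega)]
        push_cast
        have : ((lam : ℝ) + j + 1) / (j + 1) = 1 + lam / (j + 1) := by
          field_simp
          ring
        linarith
      · rw [min_eq_right (by omega), min_eq_right (by omega), min_eq_right (by omega),
          Nat.cast_sub hln.le, hγ]
        have h1 : (n : ℝ) - lam ≠ 0 := by linarith
        have h2 : (n : ℝ) - lam + 1 ≠ 0 := by linarith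
        apply le_of_eq
        field_simp
        ring
    have hw : 0 ≤ ν (lam + j + 1) * g (lam + j + 1) ^ 2 :=
      mul_nonneg (hpos _).le (sq_nonneg _)
    have key3 := mul_le_mul_of_nonneg_right hrate hw
    have hrw : (lam : ℝ) * ν (lam + j) * (g (lam + j + 1) ^ 2 / ((min j (n - lam) : ℕ) + 1))
        = ((min (lam + j + 1) n : ℕ) : ℝ) / ((min j (n - lam) : ℕ) + 1)
          * (ν (lam + j + 1) * g (lam + j + 1) ^ 2) := by
      rw [hb]
      ring
    have hrw2 : (γ + lam / ((min (j + 1) (n - lam) : ℕ) : ℝ))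
          * (ν (lam + j + 1) * g (lam + j + 1) ^ 2)
        = γ * (ν (lam + j + 1) * g (lam + j + 1) ^ 2)
          + lam * ν (lam + j + 1) * (g (lam + j + 1) ^ 2 / (min (j + 1) (n - lam) : ℕ)) := by
      ring
    rw [show lam + (j + 1) = lam + j + 1 by ring, Finset.sum_range_succ _ (lam + j + 1),
      Finset.sum_range_succ (fun q => (lam : ℝ) * ν q * (g (q + 1) - g q) ^ 2) (lam + j), mul_add]
    rw [mul_add ((lam : ℝ) * ν (lam + j))] at key2
    linarith

/-- Detailed balance for the M/M/n weights. -/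
lemma mmn_detailed_balance (n lam : ℕ) (hn : 0 < n) (ν : ℕ → ℝ) (c : ℝ)
    (hν1 : ∀ q ≤ n, ν q = c * (lam : ℝ) ^ q / (Nat.factorial q : ℝ))
    (hν2 : ∀ q > n,
      ν q = c * ((lam : ℝ) ^ n / (Nat.factorial n : ℝ)) * ((lam : ℝ) / n) ^ (q - n)) (q : ℕ) :
    (lam : ℝ) * ν q = (min (q + 1) n : ℕ) * ν (q + 1) := by
  have hn0 : (n : ℝ) ≠ 0 := by exact_mod_cast hn.ne'
  have hν2' : ∀ q ≥ n,
      ν q = c * ((lam : ℝ) ^ n / (Nat.factorial n : ℝ)) * ((lam : ℝ) / n) ^ (q - n) := by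
    intro q hq
    rcases hq.eq_or_lt with h | h
    · rw [← h, hν1 n le_rfl]
      simp
      ring
    · exact hν2 q h
  rcases lt_or_ge q n with h | h
  · rw [min_eq_left (by omega), hν1 q h.le, hν1 (q + 1) h, Nat.factorial_succ, pow_succ]
    push_cast
    have : (Nat.factorial q : ℝ) ≠ 0 := by exact_mod_cast Nat.factorial_ne_zero q
    field_simp
  · rw [min_eq_right (by omega), hν2' q h, hν2' (q + 1) (by omega),
      show q + 1 - n = (q - n) + 1 by omega, pow_succ]
    field_simp

/-- The mean minimizes the mean square deviation. -/
lemma tsum_sq_sub_mean_le (ν f : ℕ → ℝ) (hpos : ∀ q, 0 < ν q) (hsum : HasSum ν 1)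
    (hf : Summable fun q => ν q * f q ^ 2) (a : ℝ) :
    (Summable fun q => ν q * (f q - a) ^ 2) ∧
      ∑' q, ν q * (f q - ∑' p, ν p * f p) ^ 2 ≤ ∑' q, ν q * (f q - a) ^ 2 := by
  have h1 : Summable fun q => ν q * f q := by
    refine Summable.of_norm_bounded (hsum.summable.add hf) fun q => ?_
    rw [Real.norm_eq_abs, abs_mul, abs_of_pos (hpos q), ← sq_abs (f q)]
    have := mul_nonneg (hpos q).le (sq_nonneg (|f q| - 1))
    have := mul_nonneg (hpos q).le (sq_nonneg (|f q|))
    have := (hpos q).le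
    nlinarith
  have key : ∀ b : ℝ, HasSum (fun q => ν q * (f q - b) ^ 2)
      (∑' q, ν q * f q ^ 2 - 2 * b * ∑' q, ν q * f q + b ^ 2 * 1) := by
    intro b
    have h := (hf.hasSum.sub (h1.hasSum.mul_left (2 * b))).add (hsum.mul_left (b ^ 2))
    have hfun : (fun q => ν q * (f q - b) ^ 2)
        = fun q => ν q * f q ^ 2 - 2 * b * (ν q * f q) + b ^ 2 * ν q := by
      funext q
      ring
    rw [hfun]
    exact h
  refine ⟨(key a).summable, ?_⟩
  rw [(key _).tsum_eq, (key a).tsum_eq]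
  nlinarith [sq_nonneg (a - ∑' q, ν q * f q)]

/-- Poincaré inequality for the M/M/n queue with integer arrival rate in the
sub-Halfin-Whitt regime (underlying Proposition 6 of the paper): with
`γ = 1 − n/((n−λ)(n−λ+1))`, one has `γ > 0` and `Var_ν(f) ≤ (1/γ)·E(f,f)`. -/
theorem mmn_poincare_sub_halfin_whitt_integer_rate
    (n lam : ℕ) (hn : 2 ≤ n) (hlam : 1 ≤ lam)
    (hgap : Real.sqrt n < (n : ℝ) - (lam : ℝ))
    (ν : ℕ → ℝ) (c : ℝ) (hc : 0 < c)
    (hν1 : ∀ q ≤ n, ν q = c * (lam : ℝ) ^ q / (Nat.factorial q : ℝ))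
    (hν2 : ∀ q > n,
      ν q = c * ((lam : ℝ) ^ n / (Nat.factorial n : ℝ)) * ((lam : ℝ) / n) ^ (q - n))
    (hνsum : ∑' q, ν q = 1)
    (γ : ℝ)
    (hγdef : γ = 1 - (n : ℝ) / (((n : ℝ) - lam) * ((n : ℝ) - lam + 1))) :
    0 < γ ∧
      ∀ f : ℕ → ℝ, (Summable fun q => ν q * f q ^ 2) →
        (∑' q, ν q * (f q - ∑' p, ν p * f p) ^ 2)
          ≤ (1 / γ) * ∑' q, (lam : ℝ) * ν q * (f (q + 1) - f q) ^ 2 := by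
  have hk : (0 : ℝ) < (n : ℝ) - lam := (Real.sqrt_nonneg _).trans_lt hgap
  have hln : lam < n := by
    have : (lam : ℝ) < n := by linarith
    exact_mod_cast this
  have hsq : (n : ℝ) < ((n : ℝ) - lam) ^ 2 := (Real.sqrt_lt' hk).1 hgap
  have hγ0 : 0 < γ := by
    rw [hγdef, sub_pos, div_lt_one (by positivity)]
    nlinarith
  have hγ1 : γ ≤ 1 := by
    have : 0 ≤ (n : ℝ) / (((n : ℝ) - lam) * ((n : ℝ) - lam + 1)) := by positivity
    linarith
  refine ⟨hγ0, fun f hf => ?_⟩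
  have hlamR : (0 : ℝ) < lam := by exact_mod_cast hlam
  have hnR : (0 : ℝ) < n := by linarith
  have hpos : ∀ q, 0 < ν q := by
    intro q
    rcases le_or_gt q n with h | h
    · rw [hν1 q h]
      positivity
    · rw [hν2 q h]
      positivity
  have hbal := mmn_detailed_balance n lam (by omega) ν c hν1 hν2
  have hsum : HasSum ν 1 := by
    have : Summable ν := by
      by_contra h
      rw [tsum_eq_zero_of_not_summable h] at hνsum
      exact zero_ne_one hνsum
    exact hνsum ▸ this.hasSum
  obtain ⟨hsa, hvar⟩ := tsum_sq_sub_mean_le ν f hpos hsum hf (f lam)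
  have hE : Summable fun q => (lam : ℝ) * ν q * (f (q + 1) - f q) ^ 2 := by
    have hf1 : Summable fun q => ν (q + 1) * f (q + 1) ^ 2 := (summable_nat_add_iff 1).2 hf
    refine Summable.of_nonneg_of_le
      (fun q => mul_nonneg (mul_nonneg hlamR.le (hpos q).le) (sq_nonneg _)) (fun q => ?_)
      ((hf1.mul_left (2 * (n : ℝ))).add (hf.mul_left (2 * (lam : ℝ))))
    have h1 : (lam : ℝ) * ν q ≤ n * ν (q + 1) := by
      rw [hbal q]
      exact mul_le_mul_of_nonneg_right (by exact_mod_cast min_le_right _ _) (hpos _).le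
    have h2 := mul_le_mul_of_nonneg_right h1 (sq_nonneg (f (q + 1)))
    have h3 := mul_nonneg (mul_nonneg hlamR.le (hpos q).le) (sq_nonneg (f (q + 1) + f q))
    nlinarith
  have hE0 : ∀ q, 0 ≤ (lam : ℝ) * ν q * (f (q + 1) - f q) ^ 2 := fun q =>
    mul_nonneg (mul_nonneg hlamR.le (hpos q).le) (sq_nonneg _)
  have hv0 : ∀ q, 0 ≤ ν q * (f q - f lam) ^ 2 := fun q => mul_nonneg (hpos q).le (sq_nonneg _)
  have hmain : ∑' q, ν q * (f q - f lam) ^ 2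
      ≤ (1 / γ) * ∑' q, (lam : ℝ) * ν q * (f (q + 1) - f q) ^ 2 := by
    refine Real.tsum_le_of_sum_range_le hv0 fun N => ?_
    have h := sum_range_le_of_drift_above n lam hln ν (fun q => f q - f lam) hpos hbal
      (by simp) γ hγ1 hγdef N
    simp only [sub_sub_sub_cancel_right] at h
    have hb : 0 ≤ (lam : ℝ) * ν (lam + N) *
        ((f (lam + N) - f lam) ^ 2 / (min N (n - lam) : ℕ)) :=
      mul_nonneg (mul_nonneg hlamR.le (hpos _).le) (by positivity)
    have h1 := hE.sum_le_tsum (Finset.range (lam + N)) fun q _ => hE0 q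
    have h2 : ∑ q ∈ Finset.range N, ν q * (f q - f lam) ^ 2
        ≤ ∑ q ∈ Finset.range (lam + N + 1), ν q * (f q - f lam) ^ 2 :=
      Finset.sum_le_sum_of_subset_of_nonneg (Finset.range_mono (by omega)) fun q _ _ => hv0 q
    rw [one_div, ← div_eq_inv_mul, le_div_iff₀ hγ0]
    have h3 := mul_le_mul_of_nonneg_left h2 hγ0.le
    linarith
  exact hvar.trans hmain
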